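/- Let $T > 0$, $0 \le \mu < 1$, $\gamma > 0$ with $\mu + \gamma \ge 1$, $\varepsilon \in (0,1]$, $y_0 \in \mathbb{R}$, and $m \in \mathbb{N} = \{0,1,2,\dots\}$. Suppose $p_1, q_1, g_1$ are $m$ times continuously differentiable on $[0,T]$ and $K_1, K_2$ are $m$ times continuously differentiable on the triangle $D = \{(t,s) : 0 \le s \le t \le T\}$ (equivalently, each extends to a $C^m$ function on an open set containing $D$). Consider the delayed cordial Volterra integro-differential equation $$y'(t) = p_1(t)\, y(t) + q_1(t)\, y(\varepsilon t) + g_1(t) + t^{-\gamma} \int_0^t (t-s)^{-\mu} s^{\mu+\gamma-1} K_1(t,s)\, y(s)\, ds + (\varepsilon t)^{-\gamma} \int_0^{\varepsilon t} (\varepsilon t-\tau)^{-\mu} \tau^{\mu+\gamma-1} K_2(t,\tau)\, y(\tau)\, d\tau, \qquad t \in (0,T],$$ with $y(0) = y_0$, where a solution is a function that is continuous on $[0,T]$, differentiable on $(0,T]$ (one-sidedly at $T$), and satisfies the equation and the initial condition. Then there is exactly one solution $y$ on $[0,T]$, and $y$ is $(m+1)$ times continuously differentiable on $[0,T]$. 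-/

import Mathlib

open Set

/-- `x^{-γ} ∫₀^x (x - s)^{-μ} s^{μ+γ-1} k(s) y(s) ds`, the weakly singular cordial integral
with upper limit `x`, for one section `k` of the kernel. -/
noncomputable def cordialIntegral (μ γ : ℝ) (k y : ℝ → ℝ) (x : ℝ) : ℝ :=
  x ^ (-γ) * (∫ s in (0 : ℝ)..x, (x - s) ^ (-μ) * s ^ (μ + γ - 1) * k s * y s)

/-- The right-hand side of the cordial Volterra integro-differential equation with
proportional delay: the second integral has upper limit `ε t` and kernel section `K₂ t`. -/
noncomputable def cordialRHS (μ γ ε : ℝ) (p₁ q₁ g₁ : ℝ → ℝ) (K₁ K₂ : ℝ → ℝ → ℝ)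
    (y : ℝ → ℝ) (t : ℝ) : ℝ :=
  (p₁ t * y t) + (q₁ t * y (ε * t)) + (g₁ t)
    + (cordialIntegral μ γ (K₁ t) y t) + (cordialIntegral μ γ (K₂ t) y (ε * t))

/-- `y` solves the initial value problem on `[0, T]`: it is continuous on `[0, T]`, takes the
value `y₀` at `0`, and on `(0, T]` it is differentiable (one-sidedly at `T`) and satisfies the
equation. No regularity of the derivative is required. -/
def IsCordialSolution (μ γ ε y₀ T : ℝ) (p₁ q₁ g₁ : ℝ → ℝ) (K₁ K₂ : ℝ → ℝ → ℝ)
    (y : ℝ → ℝ) : Prop :=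
  ContinuousOn y (Icc 0 T) ∧ y 0 = y₀ ∧
    ∀ t ∈ Ioc (0 : ℝ) T,
      HasDerivWithinAt y (cordialRHS μ γ ε p₁ q₁ g₁ K₁ K₂ y t) (Icc 0 T) t

/-- The triangle `{(t, s) : 0 ≤ s ≤ t ≤ T}`. -/
def volterraTriangle (T : ℝ) : Set (ℝ × ℝ) :=
  {x | 0 ≤ x.2 ∧ x.2 ≤ x.1 ∧ x.1 ≤ T}

/-- The profile `(1 - σ)^{-μ} σ^{μ+γ-1}` of the cordial kernel. -/
noncomputable def cordialWeight (μ γ σ : ℝ) : ℝ := (1 - σ) ^ (-μ) * σ ^ (μ + γ - 1)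

lemma intervalIntegrable_cordialWeight {μ γ : ℝ} (hμ1 : μ < 1) (hμγ : 1 ≤ μ + γ) :
    IntervalIntegrable (cordialWeight μ γ) MeasureTheory.volume 0 1 := by
  have h1 : IntervalIntegrable (fun x : ℝ => (1 - x) ^ (-μ)) MeasureTheory.volume 0 1 := by
    have h := (intervalIntegral.intervalIntegrable_rpow' (a := 0) (b := 1)
      (r := -μ) (by linarith)).comp_sub_left 1
    simpa using h.symm
  exact h1.mul_continuousOn
    (continuousOn_id.rpow_const fun x _ => Or.inr (by linarith))

/-- The cordial integral in the scaled variable `s = x σ`. -/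
lemma cordialIntegral_eq_integral_cordialWeight (μ γ : ℝ) (k y : ℝ → ℝ) {x : ℝ} (hx : 0 < x) :
    cordialIntegral μ γ k y x =
      ∫ σ in (0 : ℝ)..1, cordialWeight μ γ σ * (k (x * σ) * y (x * σ)) := by
  have hsub := intervalIntegral.mul_integral_comp_mul_left (a := 0) (b := 1)
    (f := fun s => (x - s) ^ (-μ) * s ^ (μ + γ - 1) * k s * y s) x
  simp only [mul_zero, mul_one] at hsub
  rw [cordialIntegral, ← hsub, ← mul_assoc, ← intervalIntegral.integral_const_mul]
  refine intervalIntegral.integral_congr fun σ hσ => ?_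
  rw [uIcc_of_le zero_le_one] at hσ
  have h1 : (x - x * σ) ^ (-μ) = x ^ (-μ) * (1 - σ) ^ (-μ) := by
    rw [← Real.mul_rpow hx.le (by linarith [hσ.2])]; ring_nf
  have h2 : (x * σ) ^ (μ + γ - 1) = x ^ (μ + γ - 1) * σ ^ (μ + γ - 1) :=
    Real.mul_rpow hx.le hσ.1
  have h3 : x ^ (-γ) * x * (x ^ (-μ) * x ^ (μ + γ - 1)) = 1 := by
    nth_rw 2 [← Real.rpow_one x]
    rw [← Real.rpow_add hx, ← Real.rpow_add hx, ← Real.rpow_add hx]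
    ring_nf
    exact Real.rpow_zero x
  simp only [cordialWeight, h1, h2]
  linear_combination ((1 - σ) ^ (-μ) * σ ^ (μ + γ - 1) * k (x * σ) * y (x * σ)) * h3

/-- A weighted integral of a function continuous on a closed rectangle is continuous. -/
lemma continuousOn_weighted_integral {w : ℝ → ℝ}
    (hw : IntervalIntegrable w MeasureTheory.volume 0 1) {T : ℝ} {H : ℝ × ℝ → ℝ}
    (hH : ContinuousOn H (Icc 0 T ×ˢ Icc 0 1)) :
    ContinuousOn (fun t => ∫ σ in (0 : ℝ)..1, w σ * H (t, σ)) (Icc 0 T) := by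
  obtain ⟨C, hC⟩ := (isCompact_Icc.prod isCompact_Icc).exists_bound_of_continuousOn hH
  intro t ht
  refine intervalIntegral.continuousWithinAt_of_dominated_interval
    (bound := fun σ => ‖w σ‖ * C) ?_ ?_ (hw.norm.mul_const C) ?_
  · filter_upwards [self_mem_nhdsWithin] with r hr
    have : IntervalIntegrable (fun σ => w σ * H (r, σ)) MeasureTheory.volume 0 1 :=
      hw.mul_continuousOn (hH.comp (by fun_prop) fun σ hσ =>
        ⟨hr, by rwa [uIcc_of_le zero_le_one] at hσ⟩)
    rw [uIoc_of_le zero_le_one]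
    exact this.1.aestronglyMeasurable
  · filter_upwards [self_mem_nhdsWithin] with r hr
    refine Filter.Eventually.of_forall fun σ hσ => ?_
    rw [uIoc_of_le zero_le_one] at hσ
    rw [norm_mul]
    exact mul_le_mul_of_nonneg_left (hC _ ⟨hr, Ioc_subset_Icc_self hσ⟩) (norm_nonneg _)
  · refine Filter.Eventually.of_forall fun σ hσ => ?_
    rw [uIoc_of_le zero_le_one] at hσ
    have h : ContinuousOn (fun r => H (r, σ)) (Icc 0 T) :=
      hH.comp (by fun_prop) fun r hr => ⟨hr, Ioc_subset_Icc_self hσ⟩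
    exact continuousWithinAt_const.mul (h t ht)

/-- Differentiation of a weighted integral under the integral sign, up to the end points. -/
lemma hasDerivWithinAt_weighted_integral {w : ℝ → ℝ}
    (hw : IntervalIntegrable w MeasureTheory.volume 0 1) {T : ℝ} {H H' : ℝ × ℝ → ℝ}
    (hH : ContinuousOn H (Icc 0 T ×ˢ Icc 0 1)) (hH' : ContinuousOn H' (Icc 0 T ×ˢ Icc 0 1))
    (hd : ∀ t ∈ Icc 0 T, ∀ σ ∈ Icc (0 : ℝ) 1,
      HasDerivWithinAt (fun r => H (r, σ)) (H' (t, σ)) (Icc 0 T) t)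
    {t : ℝ} (ht : t ∈ Icc 0 T) :
    HasDerivWithinAt (fun t => ∫ σ in (0 : ℝ)..1, w σ * H (t, σ))
      (∫ σ in (0 : ℝ)..1, w σ * H' (t, σ)) (Icc 0 T) t := by
  obtain ⟨C, hC⟩ := (isCompact_Icc.prod isCompact_Icc).exists_bound_of_continuousOn hH'
  have hint : ∀ r ∈ Icc 0 T,
      IntervalIntegrable (fun σ => w σ * H (r, σ)) MeasureTheory.volume 0 1 := fun r hr =>
    hw.mul_continuousOn (hH.comp (by fun_prop) fun σ hσ =>
        ⟨hr, by rwa [uIcc_of_le zero_le_one] at hσ⟩)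
  have hslope : ∀ r σ, slope (fun r => w σ * H (r, σ)) t r = w σ * slope (fun r => H (r, σ)) t r := by
    intro r σ
    simp only [slope_def_field]; ring
  rw [hasDerivWithinAt_iff_tendsto_slope]
  have key : Filter.Tendsto
      (fun r => ∫ σ in (0 : ℝ)..1, slope (fun r => w σ * H (r, σ)) t r)
      (nhdsWithin t (Icc 0 T \ {t})) (nhds (∫ σ in (0 : ℝ)..1, w σ * H' (t, σ))) := by
    refine intervalIntegral.tendsto_integral_filter_of_dominated_convergence
      (fun σ => ‖w σ‖ * C) ?_ ?_ (hw.norm.mul_const C) ?_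
    · filter_upwards [self_mem_nhdsWithin] with r hr
      have := ((hint r hr.1).sub (hint t ht)).const_mul (r - t)⁻¹
      rw [uIoc_of_le zero_le_one]
      exact this.1.aestronglyMeasurable
    · filter_upwards [self_mem_nhdsWithin] with r hr
      refine Filter.Eventually.of_forall fun σ hσ => ?_
      rw [uIoc_of_le zero_le_one] at hσ
      have hσ' := Ioc_subset_Icc_self hσ
      rw [hslope, norm_mul]
      refine mul_le_mul_of_nonneg_left ?_ (norm_nonneg _)
      have hb := Convex.norm_image_sub_le_of_norm_hasDerivWithin_le
        (f := fun r => H (r, σ)) (f' := fun r => H' (r, σ)) (C := C)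
        (fun x hx => hd x hx σ hσ') (fun x hx => hC _ ⟨hx, hσ'⟩) (convex_Icc 0 T) ht hr.1
      have hpos : 0 < ‖r - t‖ := norm_pos_iff.2 (sub_ne_zero.2 hr.2)
      rw [slope_def_field, norm_div]
      exact (div_le_iff₀ hpos).2 hb
    · refine Filter.Eventually.of_forall fun σ hσ => ?_
      rw [uIoc_of_le zero_le_one] at hσ
      simp only [hslope]
      exact (hasDerivWithinAt_iff_tendsto_slope.1
        (hd t ht σ (Ioc_subset_Icc_self hσ))).const_mul _
  refine key.congr' ?_
  filter_upwards [self_mem_nhdsWithin] with r hr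
  simp only [slope_def_field]
  rw [intervalIntegral.integral_div, intervalIntegral.integral_sub (hint r hr.1) (hint t ht)]

/-- A weighted integral of a function of class `C^n` on a closed rectangle is of class `C^n`. -/
lemma contDiffOn_weighted_integral {w : ℝ → ℝ}
    (hw : IntervalIntegrable w MeasureTheory.volume 0 1) {T : ℝ} (hT : 0 < T) (n : ℕ)
    {H : ℝ × ℝ → ℝ} (hH : ContDiffOn ℝ n H (Icc 0 T ×ˢ Icc 0 1)) :
    ContDiffOn ℝ n (fun t => ∫ σ in (0 : ℝ)..1, w σ * H (t, σ)) (Icc 0 T) := by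
  induction n generalizing H with
  | zero =>
    exact contDiffOn_zero.2 (continuousOn_weighted_integral hw hH.continuousOn)
  | succ n ih =>
    have hS : UniqueDiffOn ℝ (Icc (0 : ℝ) T ×ˢ Icc (0 : ℝ) 1) :=
      (uniqueDiffOn_Icc hT).prod (uniqueDiffOn_Icc zero_lt_one)
    set H' : ℝ × ℝ → ℝ := fun x => fderivWithin ℝ H (Icc 0 T ×ˢ Icc 0 1) x (1, 0) with hH'def
    have hH' : ContDiffOn ℝ n H' (Icc 0 T ×ˢ Icc 0 1) :=
      (hH.fderivWithin hS (by push_cast; exact le_rfl)).clm_apply contDiffOn_const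
    have hd : ∀ t ∈ Icc 0 T, ∀ σ ∈ Icc (0 : ℝ) 1,
        HasDerivWithinAt (fun r => H (r, σ)) (H' (t, σ)) (Icc 0 T) t := by
      intro t ht σ hσ
      have h1 := (hH.differentiableOn (by simp) (t, σ) ⟨ht, hσ⟩).hasFDerivWithinAt
      have h2 : HasDerivWithinAt (fun r : ℝ => (r, σ)) ((1 : ℝ), (0 : ℝ)) (Icc 0 T) t :=
        (hasDerivWithinAt_id t _).prodMk (hasDerivWithinAt_const t _ σ)
      have h3 : MapsTo (fun r : ℝ => (r, σ)) (Icc 0 T) (Icc 0 T ×ˢ Icc 0 1) :=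
        fun r hr => ⟨hr, hσ⟩
      exact h1.comp_hasDerivWithinAt t h2 h3
    have hG := fun t (ht : t ∈ Icc 0 T) =>
      hasDerivWithinAt_weighted_integral hw hH.continuousOn hH'.continuousOn hd ht
    push_cast
    rw [contDiffOn_succ_iff_derivWithin (uniqueDiffOn_Icc hT)]
    refine ⟨fun t ht => (hG t ht).differentiableWithinAt, by simp, ?_⟩
    exact (ih hH').congr fun t ht => (hG t ht).derivWithin (uniqueDiffOn_Icc hT t ht)

lemma hasDerivWithinAt_const_add_integral {T : ℝ} (hT : 0 < T) {f : ℝ → ℝ}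
    (hf : ContinuousOn f (Icc 0 T)) (c : ℝ) {t : ℝ} (ht : t ∈ Icc 0 T) :
    HasDerivWithinAt (fun t => c + ∫ s in (0 : ℝ)..t, f s) (f t) (Icc 0 T) t := by
  set g : ℝ → ℝ := IccExtend hT.le ((Icc 0 T).domRestrict f) with hg
  have hgc : Continuous g := (continuousOn_iff_continuous_domRestrict.1 hf).Icc_extend'
  have hgf : ∀ s ∈ Icc 0 T, g s = f s := fun s hs => IccExtend_of_mem hT.le _ hs
  have h := ((hgc.integral_hasStrictDerivAt 0 t).hasDerivAt.const_add c).hasDerivWithinAt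
    (s := Icc 0 T)
  rw [hgf t ht] at h
  refine h.congr_of_mem (fun r hr => ?_) ht
  congr 1
  refine intervalIntegral.integral_congr fun s hs => ?_
  rw [uIcc_of_le hr.1] at hs
  exact (hgf s ⟨hs.1, hs.2.trans hr.2⟩).symm

lemma contDiffOn_const_add_integral {T : ℝ} (hT : 0 < T) {n : ℕ} {f : ℝ → ℝ}
    (hf : ContDiffOn ℝ n f (Icc 0 T)) (c : ℝ) :
    ContDiffOn ℝ ((n + 1 : ℕ) : WithTop ℕ∞) (fun t => c + ∫ s in (0 : ℝ)..t, f s)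
      (Icc 0 T) := by
  have hG := fun t (ht : t ∈ Icc 0 T) =>
    hasDerivWithinAt_const_add_integral hT hf.continuousOn c ht
  push_cast
  rw [contDiffOn_succ_iff_derivWithin (uniqueDiffOn_Icc hT)]
  exact ⟨fun t ht => (hG t ht).differentiableWithinAt, by simp,
    hf.congr fun t ht => (hG t ht).derivWithin (uniqueDiffOn_Icc hT t ht)⟩

/-- A Volterra operator on `C[0, T]`: it preserves continuity, and it is Lipschitz at each time
with respect to the supremum of the past. -/
structure IsLipschitzVolterra (T C : ℝ) (F : (ℝ → ℝ) → ℝ → ℝ) : Prop where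
  continuousOn : ∀ y, ContinuousOn y (Icc 0 T) → ContinuousOn (F y) (Icc 0 T)
  lipschitz : ∀ y z, ContinuousOn y (Icc 0 T) → ContinuousOn z (Icc 0 T) →
    ∀ t ∈ Icc 0 T, ∀ M, (∀ s ∈ Icc 0 t, |y s - z s| ≤ M) → |F y t - F z t| ≤ C * M

namespace IsLipschitzVolterra

variable {T C : ℝ} {F : (ℝ → ℝ) → ℝ → ℝ}

lemma intervalIntegrable (hF : IsLipschitzVolterra T C F) {y : ℝ → ℝ}
    (hy : ContinuousOn y (Icc 0 T)) {t : ℝ} (ht : t ∈ Icc 0 T) :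
    IntervalIntegrable (F y) MeasureTheory.volume 0 t :=
  ((hF.continuousOn y hy).mono (Icc_subset_Icc_right ht.2)).intervalIntegrable_of_Icc ht.1

/-- In the norm weighted by `exp (-2 C t)` the primitive of `F` is a contraction. -/
lemma abs_integral_sub_le (hF : IsLipschitzVolterra T C F) (hC : 0 < C) {y z : ℝ → ℝ}
    (hy : ContinuousOn y (Icc 0 T)) (hz : ContinuousOn z (Icc 0 T)) {M : ℝ} (hM : 0 ≤ M)
    (hyz : ∀ s ∈ Icc 0 T, |y s - z s| ≤ M * Real.exp (2 * C * s)) {t : ℝ} (ht : t ∈ Icc 0 T) :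
    |(∫ s in (0 : ℝ)..t, F y s) - ∫ s in (0 : ℝ)..t, F z s| ≤
      M / 2 * Real.exp (2 * C * t) := by
  have hprim : ∀ s : ℝ, HasDerivAt (fun s => M / 2 * Real.exp (2 * C * s))
      (C * (M * Real.exp (2 * C * s))) s := by
    intro s
    have h := (((hasDerivAt_id s).const_mul (2 * C)).exp).const_mul (M / 2)
    exact h.congr_deriv (by simp only [id]; ring)
  have hint : IntervalIntegrable (fun s => C * (M * Real.exp (2 * C * s)))
      MeasureTheory.volume 0 t := (by fun_prop : Continuous _).intervalIntegrable _ _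
  rw [← intervalIntegral.integral_sub (hF.intervalIntegrable hy ht) (hF.intervalIntegrable hz ht),
    ← Real.norm_eq_abs]
  refine (intervalIntegral.norm_integral_le_of_norm_le ht.1
    (Filter.Eventually.of_forall fun s hs => ?_) hint).trans ?_
  · have hsT : s ∈ Icc 0 T := ⟨hs.1.le, hs.2.trans ht.2⟩
    refine hF.lipschitz y z hy hz s hsT _ fun r hr => (hyz r ⟨hr.1, hr.2.trans hsT.2⟩).trans ?_
    have := hr.2
    gcongr
  · rw [intervalIntegral.integral_eq_sub_of_hasDerivAt (fun s _ => hprim s) hint]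
    have : 0 ≤ M / 2 * Real.exp (2 * C * 0) := by positivity
    linarith

lemma eqOn_of_integral_eq (hF : IsLipschitzVolterra T C F) (hC : 0 < C) {y₀ : ℝ}
    {y z : ℝ → ℝ} (hy : ContinuousOn y (Icc 0 T)) (hz : ContinuousOn z (Icc 0 T))
    (hye : ∀ t ∈ Icc 0 T, y t = y₀ + ∫ s in (0 : ℝ)..t, F y s)
    (hze : ∀ t ∈ Icc 0 T, z t = y₀ + ∫ s in (0 : ℝ)..t, F z s) : EqOn z y (Icc 0 T) := by
  intro t₀ ht₀
  have hcont : ContinuousOn (fun t => |y t - z t| * Real.exp (-(2 * C * t))) (Icc 0 T) :=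
    (hy.sub hz).abs.mul (by fun_prop)
  obtain ⟨t₁, ht₁, hmax⟩ := isCompact_Icc.exists_isMaxOn ⟨t₀, ht₀⟩ hcont
  set M := |y t₁ - z t₁| * Real.exp (-(2 * C * t₁)) with hMdef
  have hM : 0 ≤ M := by positivity
  have hexp : ∀ t : ℝ, Real.exp (-(2 * C * t)) * Real.exp (2 * C * t) = 1 := fun t => by
    rw [← Real.exp_add]; simp
  have hyz : ∀ s ∈ Icc 0 T, |y s - z s| ≤ M * Real.exp (2 * C * s) := by
    intro s hs
    have h1 : |y s - z s| * Real.exp (-(2 * C * s)) ≤ M := hmax hs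
    calc |y s - z s| = |y s - z s| * Real.exp (-(2 * C * s)) * Real.exp (2 * C * s) := by
          rw [mul_assoc, hexp, mul_one]
      _ ≤ M * Real.exp (2 * C * s) := by gcongr
  have h := hF.abs_integral_sub_le hC hy hz hM hyz ht₁
  have hM0 : M ≤ M / 2 := by
    calc M = |(∫ s in (0 : ℝ)..t₁, F y s) - ∫ s in (0 : ℝ)..t₁, F z s| *
          Real.exp (-(2 * C * t₁)) := by
            rw [hMdef, hye t₁ ht₁, hze t₁ ht₁]; ring_nf
      _ ≤ M / 2 * Real.exp (2 * C * t₁) * Real.exp (-(2 * C * t₁)) := by gcongr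
      _ = M / 2 := by rw [mul_assoc, mul_comm (Real.exp _), hexp, mul_one]
  have hM00 : M = 0 := by linarith
  have h0 := hyz t₀ ht₀
  rw [hM00, zero_mul] at h0
  exact (sub_eq_zero.1 (abs_nonpos_iff.1 h0)).symm

lemma exists_integral_eq (hF : IsLipschitzVolterra T C F) (hT : 0 < T) (hC : 0 < C) (y₀ : ℝ) :
    ∃ y : ℝ → ℝ, ContinuousOn y (Icc 0 T) ∧
      ∀ t ∈ Icc 0 T, y t = y₀ + ∫ s in (0 : ℝ)..t, F y s := by
  set Y : C(Icc (0 : ℝ) T, ℝ) → ℝ → ℝ := fun u t =>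
    Real.exp (2 * C * t) * IccExtend hT.le u t with hYdef
  have hY : ∀ u, ContinuousOn (Y u) (Icc 0 T) := fun u =>
    ((by fun_prop : Continuous fun t : ℝ => Real.exp (2 * C * t)).mul
      u.continuous.Icc_extend').continuousOn
  have hYmem : ∀ u t (ht : t ∈ Icc 0 T), Y u t = Real.exp (2 * C * t) * u ⟨t, ht⟩ := fun u t ht => by
    simp only [hYdef, IccExtend_of_mem hT.le _ ht]
  have hprim : ∀ u, ContinuousOn (fun t => Real.exp (-(2 * C * t)) *
      (y₀ + ∫ s in (0 : ℝ)..t, F (Y u) s)) (Icc 0 T) := fun u =>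
    ContinuousOn.mul (by fun_prop) fun t ht =>
      (hasDerivWithinAt_const_add_integral hT (hF.continuousOn _ (hY u)) y₀ ht).continuousWithinAt
  set Φ : C(Icc (0 : ℝ) T, ℝ) → C(Icc (0 : ℝ) T, ℝ) := fun u =>
    ⟨(Icc 0 T).domRestrict fun t => Real.exp (-(2 * C * t)) * (y₀ + ∫ s in (0 : ℝ)..t, F (Y u) s),
      continuousOn_iff_continuous_domRestrict.1 (hprim u)⟩ with hΦdef
  have hexp : ∀ t : ℝ, Real.exp (2 * C * t) * Real.exp (-(2 * C * t)) = 1 := fun t => by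
    rw [← Real.exp_add]; simp
  have hΦ : ContractingWith (1 / 2 : NNReal) Φ := by
    refine ⟨by rw [← NNReal.coe_lt_coe]; norm_num, LipschitzWith.of_dist_le_mul fun u v => ?_⟩
    refine (ContinuousMap.dist_le (by positivity)).2 fun t => ?_
    have hyz : ∀ s ∈ Icc 0 T, |Y u s - Y v s| ≤ dist u v * Real.exp (2 * C * s) := by
      intro s hs
      rw [hYmem u s hs, hYmem v s hs, ← mul_sub, abs_mul, abs_of_pos (Real.exp_pos _), mul_comm]
      gcongr
      exact ContinuousMap.dist_apply_le_dist (f := u) (g := v) ⟨s, hs⟩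
    have h := hF.abs_integral_sub_le hC (hY u) (hY v) dist_nonneg hyz t.2
    have h1 : dist (Φ u t) (Φ v t) = Real.exp (-(2 * C * t)) *
        |(∫ s in (0 : ℝ)..t, F (Y u) s) - ∫ s in (0 : ℝ)..t, F (Y v) s| := by
      rw [Real.dist_eq, ← abs_of_pos (Real.exp_pos (-(2 * C * t))), ← abs_mul]
      simp only [hΦdef, ContinuousMap.coe_mk, domRestrict_apply]
      ring_nf
    rw [h1]
    calc _ ≤ Real.exp (-(2 * C * t)) * (dist u v / 2 * Real.exp (2 * C * t)) := by gcongr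
      _ = (Real.exp (2 * C * t) * Real.exp (-(2 * C * t))) * (dist u v / 2) := by ring
      _ = _ := by rw [hexp]; push_cast; ring
  set u := ContractingWith.fixedPoint Φ hΦ with hu
  have hfix : Φ u = u := hΦ.fixedPoint_isFixedPt
  refine ⟨Y u, hY u, fun t ht => ?_⟩
  have h1 : u ⟨t, ht⟩ = Real.exp (-(2 * C * t)) * (y₀ + ∫ s in (0 : ℝ)..t, F (Y u) s) := by
    conv_lhs => rw [← hfix]
    rfl
  rw [hYmem u t ht, h1, ← mul_assoc, hexp, one_mul]

end IsLipschitzVolterra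

/-- If `F` preserves `C^n` for `n ≤ m`, continuous solutions of `y = y₀ + ∫ F y` are
of class `C^{m+1}`. -/
lemma contDiffOn_of_integral_eq {T : ℝ} (hT : 0 < T) {F : (ℝ → ℝ) → ℝ → ℝ} {y₀ : ℝ} {m : ℕ}
    (hreg : ∀ n ≤ m, ∀ y, ContDiffOn ℝ n y (Icc 0 T) → ContDiffOn ℝ n (F y) (Icc 0 T))
    {y : ℝ → ℝ} (hy : ContinuousOn y (Icc 0 T))
    (hye : ∀ t ∈ Icc 0 T, y t = y₀ + ∫ s in (0 : ℝ)..t, F y s) :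
    ContDiffOn ℝ ((m + 1 : ℕ) : WithTop ℕ∞) y (Icc 0 T) := by
  have key : ∀ n ≤ m + 1, ContDiffOn ℝ n y (Icc 0 T) := by
    intro n
    induction n with
    | zero => exact fun _ => contDiffOn_zero.2 hy
    | succ n ih =>
      intro hn
      exact (contDiffOn_const_add_integral hT
        (hreg n (by omega) y (ih (by omega))) y₀).congr hye
  exact key (m + 1) le_rfl

/-- The integral `∫₀¹ w(σ) K(t, e t σ) y(e t σ) dσ`. -/
noncomputable def scaledIntegral (w : ℝ → ℝ) (K : ℝ → ℝ → ℝ) (e : ℝ) (y : ℝ → ℝ) (t : ℝ) : ℝ :=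
  ∫ σ in (0 : ℝ)..1, w σ * (K t (e * t * σ) * y (e * t * σ))

section ScaledIntegral

variable {T e t σ : ℝ}

lemma mul_mul_mem_Icc (he0 : 0 ≤ e) (he1 : e ≤ 1) (ht : 0 ≤ t) (hσ : σ ∈ Icc (0 : ℝ) 1) :
    e * t * σ ∈ Icc 0 t := by
  have h1 : 0 ≤ e * t := mul_nonneg he0 ht
  have h2 : e * t ≤ t := mul_le_of_le_one_left ht he1
  exact ⟨mul_nonneg h1 hσ.1, (mul_le_of_le_one_right h1 hσ.2).trans h2⟩

lemma contDiffOn_scaled_integrand (he0 : 0 ≤ e) (he1 : e ≤ 1) {n : ℕ} {K : ℝ → ℝ → ℝ}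
    (hK : ContDiffOn ℝ n (fun x : ℝ × ℝ => K x.1 x.2) (volterraTriangle T))
    {y : ℝ → ℝ} (hy : ContDiffOn ℝ n y (Icc 0 T)) :
    ContDiffOn ℝ n (fun x : ℝ × ℝ => K x.1 (e * x.1 * x.2) * y (e * x.1 * x.2))
      (Icc 0 T ×ˢ Icc 0 1) := by
  have h1 : MapsTo (fun x : ℝ × ℝ => (x.1, e * x.1 * x.2)) (Icc 0 T ×ˢ Icc 0 1)
      (volterraTriangle T) := fun x hx =>
    have h := mul_mul_mem_Icc he0 he1 hx.1.1 hx.2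
    ⟨h.1, h.2, hx.1.2⟩
  have h2 : MapsTo (fun x : ℝ × ℝ => e * x.1 * x.2) (Icc 0 T ×ˢ Icc 0 1) (Icc 0 T) :=
    fun x hx =>
      have h := mul_mul_mem_Icc he0 he1 hx.1.1 hx.2
      ⟨h.1, h.2.trans hx.1.2⟩
  exact (hK.comp (by fun_prop) h1).mul (hy.comp (by fun_prop) h2)

lemma contDiffOn_scaledIntegral {w : ℝ → ℝ}
    (hw : IntervalIntegrable w MeasureTheory.volume 0 1) (hT : 0 < T) (he0 : 0 ≤ e) (he1 : e ≤ 1)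
    {n : ℕ} {K : ℝ → ℝ → ℝ}
    (hK : ContDiffOn ℝ n (fun x : ℝ × ℝ => K x.1 x.2) (volterraTriangle T))
    {y : ℝ → ℝ} (hy : ContDiffOn ℝ n y (Icc 0 T)) :
    ContDiffOn ℝ n (scaledIntegral w K e y) (Icc 0 T) :=
  contDiffOn_weighted_integral hw hT n (contDiffOn_scaled_integrand he0 he1 hK hy)

lemma abs_scaledIntegral_sub_le {w : ℝ → ℝ}
    (hw : IntervalIntegrable w MeasureTheory.volume 0 1) (he0 : 0 ≤ e) (he1 : e ≤ 1)
    {K : ℝ → ℝ → ℝ} (hK : ContinuousOn (fun x : ℝ × ℝ => K x.1 x.2) (volterraTriangle T))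
    {k : ℝ} (hk : ∀ x ∈ volterraTriangle T, |K x.1 x.2| ≤ k)
    {y z : ℝ → ℝ} (hy : ContinuousOn y (Icc 0 T)) (hz : ContinuousOn z (Icc 0 T))
    (ht : t ∈ Icc 0 T) {M : ℝ} (hM : ∀ s ∈ Icc 0 t, |y s - z s| ≤ M) :
    |scaledIntegral w K e y t - scaledIntegral w K e z t| ≤
      (∫ σ in (0 : ℝ)..1, |w σ|) * k * M := by
  have hint : ∀ y : ℝ → ℝ, ContinuousOn y (Icc 0 T) → IntervalIntegrable
      (fun σ => w σ * (K t (e * t * σ) * y (e * t * σ))) MeasureTheory.volume 0 1 := by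
    intro y hy
    refine hw.mul_continuousOn ?_
    have h := (contDiffOn_scaled_integrand (n := 0) he0 he1 (contDiffOn_zero.2 hK)
      (contDiffOn_zero.2 hy)).continuousOn
    have h1 : MapsTo (fun σ : ℝ => (t, σ)) (uIcc 0 1) (Icc 0 T ×ˢ Icc 0 1) := fun σ hσ =>
      ⟨ht, by rwa [uIcc_of_le zero_le_one] at hσ⟩
    exact h.comp (by fun_prop) h1
  rw [scaledIntegral, scaledIntegral, ← intervalIntegral.integral_sub (hint y hy) (hint z hz),
    ← Real.norm_eq_abs, mul_assoc, ← intervalIntegral.integral_mul_const]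
  refine intervalIntegral.norm_integral_le_of_norm_le zero_le_one
    (Filter.Eventually.of_forall fun σ hσ => ?_) (hw.abs.mul_const _)
  have hs := mul_mul_mem_Icc he0 he1 ht.1 (Ioc_subset_Icc_self hσ)
  have hk' := hk (t, e * t * σ) ⟨hs.1, hs.2, ht.2⟩
  rw [← mul_sub, ← mul_sub, Real.norm_eq_abs, abs_mul, abs_mul]
  have := hM _ hs
  gcongr
  exact (abs_nonneg _).trans hk'

end ScaledIntegral

lemma isCompact_volterraTriangle (T : ℝ) : IsCompact (volterraTriangle T) := by
  refine (isCompact_Icc (a := ((0 : ℝ), (0 : ℝ))) (b := (T, T))).of_isClosed_subset ?_ ?_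
  · exact (isClosed_le continuous_const continuous_snd).inter
      ((isClosed_le continuous_snd continuous_fst).inter
        (isClosed_le continuous_fst continuous_const))
  · rintro ⟨t, s⟩ ⟨h0, h1, h2⟩
    simp only at h0 h1 h2
    exact ⟨⟨h0.trans h1, h0⟩, ⟨h2, h1.trans h2⟩⟩

/-- The right-hand side of the equation in the scaled variable. It agrees with `cordialRHS` for
`t > 0` and is continuous up to `t = 0`. -/
noncomputable def scaledRHS (μ γ ε : ℝ) (p₁ q₁ g₁ : ℝ → ℝ) (K₁ K₂ : ℝ → ℝ → ℝ)
    (y : ℝ → ℝ) (t : ℝ) : ℝ :=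
  p₁ t * y t + q₁ t * y (ε * t) + g₁ t
    + scaledIntegral (cordialWeight μ γ) K₁ 1 y t + scaledIntegral (cordialWeight μ γ) K₂ ε y t

section ScaledRHS

variable {T μ γ ε : ℝ} {p₁ q₁ g₁ : ℝ → ℝ} {K₁ K₂ : ℝ → ℝ → ℝ}

lemma cordialRHS_eq_scaledRHS (hε0 : 0 < ε) (y : ℝ → ℝ) {t : ℝ} (ht : 0 < t) :
    cordialRHS μ γ ε p₁ q₁ g₁ K₁ K₂ y t = scaledRHS μ γ ε p₁ q₁ g₁ K₁ K₂ y t := by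
  rw [cordialRHS, scaledRHS, cordialIntegral_eq_integral_cordialWeight _ _ _ _ ht,
    cordialIntegral_eq_integral_cordialWeight _ _ _ _ (mul_pos hε0 ht)]
  simp only [scaledIntegral, one_mul]

lemma contDiffOn_scaledRHS (hT : 0 < T) (hμ1 : μ < 1) (hμγ : 1 ≤ μ + γ) (hε0 : 0 < ε)
    (hε1 : ε ≤ 1) {n : ℕ}
    (hp : ContDiffOn ℝ n p₁ (Icc 0 T)) (hq : ContDiffOn ℝ n q₁ (Icc 0 T))
    (hg : ContDiffOn ℝ n g₁ (Icc 0 T))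
    (hK₁ : ContDiffOn ℝ n (fun x : ℝ × ℝ => K₁ x.1 x.2) (volterraTriangle T))
    (hK₂ : ContDiffOn ℝ n (fun x : ℝ × ℝ => K₂ x.1 x.2) (volterraTriangle T))
    {y : ℝ → ℝ} (hy : ContDiffOn ℝ n y (Icc 0 T)) :
    ContDiffOn ℝ n (scaledRHS μ γ ε p₁ q₁ g₁ K₁ K₂ y) (Icc 0 T) := by
  have hw := intervalIntegrable_cordialWeight hμ1 hμγ
  have hmap : MapsTo (fun t : ℝ => ε * t) (Icc 0 T) (Icc 0 T) := fun t ht =>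
    ⟨mul_nonneg hε0.le ht.1, (mul_le_of_le_one_left ht.1 hε1).trans ht.2⟩
  exact ((((hp.mul hy).add (hq.mul (hy.comp (by fun_prop) hmap))).add hg).add
    (contDiffOn_scaledIntegral hw hT zero_le_one le_rfl hK₁ hy)).add
    (contDiffOn_scaledIntegral hw hT hε0.le hε1 hK₂ hy)

lemma exists_isLipschitzVolterra_scaledRHS (hT : 0 < T) (hμ1 : μ < 1) (hμγ : 1 ≤ μ + γ)
    (hε0 : 0 < ε) (hε1 : ε ≤ 1)
    (hp : ContinuousOn p₁ (Icc 0 T)) (hq : ContinuousOn q₁ (Icc 0 T))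
    (hg : ContinuousOn g₁ (Icc 0 T))
    (hK₁ : ContinuousOn (fun x : ℝ × ℝ => K₁ x.1 x.2) (volterraTriangle T))
    (hK₂ : ContinuousOn (fun x : ℝ × ℝ => K₂ x.1 x.2) (volterraTriangle T)) :
    ∃ C, 0 < C ∧ IsLipschitzVolterra T C (scaledRHS μ γ ε p₁ q₁ g₁ K₁ K₂) := by
  have hw := intervalIntegrable_cordialWeight hμ1 hμγ
  obtain ⟨P, hP⟩ := isCompact_Icc.exists_bound_of_continuousOn hp
  obtain ⟨Q, hQ⟩ := isCompact_Icc.exists_bound_of_continuousOn hq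
  obtain ⟨k₁, hk₁⟩ := (isCompact_volterraTriangle T).exists_bound_of_continuousOn hK₁
  obtain ⟨k₂, hk₂⟩ := (isCompact_volterraTriangle T).exists_bound_of_continuousOn hK₂
  simp only [Real.norm_eq_abs] at hP hQ hk₁ hk₂
  set W := ∫ σ in (0 : ℝ)..1, |cordialWeight μ γ σ| with hW
  refine ⟨|P + Q + W * k₁ + W * k₂| + 1, by positivity, ⟨fun y hy => ?_, ?_⟩⟩
  · exact (contDiffOn_scaledRHS (n := 0) hT hμ1 hμγ hε0 hε1 (contDiffOn_zero.2 hp)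
      (contDiffOn_zero.2 hq) (contDiffOn_zero.2 hg) (contDiffOn_zero.2 hK₁)
      (contDiffOn_zero.2 hK₂) (contDiffOn_zero.2 hy)).continuousOn
  intro y z hy hz t ht M hM
  have hεt : ε * t ∈ Icc 0 t := ⟨mul_nonneg hε0.le ht.1, mul_le_of_le_one_left ht.1 hε1⟩
  have hM0 : 0 ≤ M := (abs_nonneg _).trans (hM t ⟨ht.1, le_rfl⟩)
  have h1 : |p₁ t * (y t - z t)| ≤ P * M := by
    rw [abs_mul]
    exact mul_le_mul (hP t ht) (hM t ⟨ht.1, le_rfl⟩) (abs_nonneg _)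
      ((abs_nonneg _).trans (hP t ht))
  have h2 : |q₁ t * (y (ε * t) - z (ε * t))| ≤ Q * M := by
    rw [abs_mul]
    exact mul_le_mul (hQ t ht) (hM _ hεt) (abs_nonneg _) ((abs_nonneg _).trans (hQ t ht))
  have h3 := abs_scaledIntegral_sub_le hw zero_le_one le_rfl hK₁ hk₁ hy hz ht hM
  have h4 := abs_scaledIntegral_sub_le hw hε0.le hε1 hK₂ hk₂ hy hz ht hM
  rw [← hW] at h3 h4
  set A := scaledIntegral (cordialWeight μ γ) K₁ 1 y t -
    scaledIntegral (cordialWeight μ γ) K₁ 1 z t with hA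
  set B := scaledIntegral (cordialWeight μ γ) K₂ ε y t -
    scaledIntegral (cordialWeight μ γ) K₂ ε z t with hB
  have hsum : scaledRHS μ γ ε p₁ q₁ g₁ K₁ K₂ y t - scaledRHS μ γ ε p₁ q₁ g₁ K₁ K₂ z t =
      p₁ t * (y t - z t) + q₁ t * (y (ε * t) - z (ε * t)) + A + B := by
    simp only [scaledRHS, hA, hB]; ring
  rw [hsum]
  calc _ ≤ P * M + Q * M + W * k₁ * M + W * k₂ * M := by
        refine (abs_add_le _ _).trans (add_le_add ?_ h4)
        refine (abs_add_le _ _).trans (add_le_add ?_ h3)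
        exact (abs_add_le _ _).trans (add_le_add h1 h2)
    _ = (P + Q + W * k₁ + W * k₂) * M := by ring
    _ ≤ _ := by
        refine mul_le_mul_of_nonneg_right ?_ hM0
        exact (le_abs_self _).trans (by linarith)

/-- Solutions of the initial value problem are the continuous solutions of `y = y₀ + ∫ F y`. -/
lemma isCordialSolution_iff_integral_eq (hT : 0 < T) (hε0 : 0 < ε) {C : ℝ}
    (hF : IsLipschitzVolterra T C (scaledRHS μ γ ε p₁ q₁ g₁ K₁ K₂)) {y₀ : ℝ} {y : ℝ → ℝ} :
    IsCordialSolution μ γ ε y₀ T p₁ q₁ g₁ K₁ K₂ y ↔ ContinuousOn y (Icc 0 T) ∧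
      ∀ t ∈ Icc 0 T, y t = y₀ + ∫ s in (0 : ℝ)..t, scaledRHS μ γ ε p₁ q₁ g₁ K₁ K₂ y s := by
  constructor
  · rintro ⟨hy, h0, hd⟩
    refine ⟨hy, fun t ht => ?_⟩
    rw [intervalIntegral.integral_eq_sub_of_hasDerivAt_of_le ht.1
      (hy.mono (Icc_subset_Icc_right ht.2)) (fun s hs => ?_) (hF.intervalIntegrable hy ht), h0]
    · ring
    · have hsT : s < T := hs.2.trans_le ht.2
      rw [← cordialRHS_eq_scaledRHS hε0 y hs.1]
      exact (hd s ⟨hs.1, hsT.le⟩).hasDerivAt (Icc_mem_nhds hs.1 hsT)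
  · rintro ⟨hy, he⟩
    refine ⟨hy, by simpa using he 0 ⟨le_rfl, hT.le⟩, fun t ht => ?_⟩
    have htI := Ioc_subset_Icc_self ht
    rw [cordialRHS_eq_scaledRHS hε0 y ht.1]
    exact (hasDerivWithinAt_const_add_integral hT (hF.continuousOn y hy) y₀ htI).congr_of_mem
      he htI

end ScaledRHS

/-- If the data are `C^m`, the initial value problem for the delayed cordial Volterra
integro-differential equation has a solution of class `C^{m+1}` on `[0, T]`, and every solution
coincides with it on `[0, T]`. -/
theorem regularity_cordial_VIDE
    (T μ γ ε y₀ : ℝ) (m : ℕ) (hT : 0 < T) (hμ0 : 0 ≤ μ) (hμ1 : μ < 1)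
    (hγ : 0 < γ) (hμγ : 1 ≤ μ + γ) (hε0 : 0 < ε) (hε1 : ε ≤ 1)
    (p₁ q₁ g₁ : ℝ → ℝ) (K₁ K₂ : ℝ → ℝ → ℝ)
    (hp : ContDiffOn ℝ m p₁ (Set.Icc 0 T))
    (hq : ContDiffOn ℝ m q₁ (Set.Icc 0 T))
    (hg : ContDiffOn ℝ m g₁ (Set.Icc 0 T))
    (hK₁ : ContDiffOn ℝ m (fun x : ℝ × ℝ => K₁ x.1 x.2) (volterraTriangle T))
    (hK₂ : ContDiffOn ℝ m (fun x : ℝ × ℝ => K₂ x.1 x.2) (volterraTriangle T)) :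
    ∃ y : ℝ → ℝ,
      IsCordialSolution μ γ ε y₀ T p₁ q₁ g₁ K₁ K₂ y ∧
      ContDiffOn ℝ ((m + 1 : ℕ) : WithTop ℕ∞) y (Set.Icc 0 T) ∧
      ∀ z : ℝ → ℝ, IsCordialSolution μ γ ε y₀ T p₁ q₁ g₁ K₁ K₂ z →
        Set.EqOn z y (Set.Icc 0 T) := by
  obtain ⟨C, hC, hF⟩ := exists_isLipschitzVolterra_scaledRHS (μ := μ) (γ := γ) hT hμ1 hμγ hε0 hε1
    hp.continuousOn hq.continuousOn hg.continuousOn hK₁.continuousOn hK₂.continuousOn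
  obtain ⟨y, hy, hye⟩ := hF.exists_integral_eq hT hC y₀
  refine ⟨y, (isCordialSolution_iff_integral_eq hT hε0 hF).2 ⟨hy, hye⟩,
    contDiffOn_of_integral_eq hT (fun n hn u hu => ?_) hy hye, fun z hz => ?_⟩
  · have hnm : (n : WithTop ℕ∞) ≤ m := by exact_mod_cast hn
    exact contDiffOn_scaledRHS hT hμ1 hμγ hε0 hε1 (hp.of_le hnm) (hq.of_le hnm)
      (hg.of_le hnm) (hK₁.of_le hnm) (hK₂.of_le hnm) hu
  · obtain ⟨hzc, hze⟩ := (isCordialSolution_iff_integral_eq hT hε0 hF).1 hz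
    exact hF.eqOn_of_integral_eq hC hy hzc hye hze
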